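/- Fix a real number c, a real number a with a > 0 and a + c > 0, and an integer r ≥ 1. Let A_EC = { f ∈ D : φ_EC(f) ≥ a }, where φ_EC(f) = sup_{t∈[0,1]} { f(t) − c t − (r+1)·J_r^t(f) + r·J_{r+1}^t(f) }. Then the infimum, over all nondecreasing step functions f vanishing at the origin (with all step times in (0,1), pairwise distinct, and strictly positive step sizes) belonging to A_EC, of the number of steps of f, equals r+1. -/

import Mathlib

open MeasureTheory Filter Set Polynomial

noncomputable section

/-- Jump of `f` at `s`, with the convention `f(0⁻) = f(0)` (so the jump at `0` is `0`). -/
def jumpAt (f : ℝ → ℝ) (s : ℝ) : ℝ :=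
  if s = 0 then 0 else f s - Function.leftLim f s

/-- `J m t f`: supremum over `m`-tuples of pairwise distinct points of `[0,t]` of the
sum of the jumps of `f` at these points (`J m 0 f = 0`). -/
def J (m : ℕ) (t : ℝ) (f : ℝ → ℝ) : ℝ :=
  ⨆ s : { s : Fin m → ℝ // (∀ i, s i ∈ Set.Icc 0 t) ∧ Function.Injective s },
    ∑ i, jumpAt f (s.val i)

/-- `f` is càdlàg on `[0,1]`: right-continuous, with left limits. -/
def Cadlag (f : ℝ → ℝ) : Prop :=
  (∀ x ∈ Set.Icc (0:ℝ) 1, ContinuousWithinAt f (Set.Ici x) x) ∧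
  (∀ x ∈ Set.Ioc (0:ℝ) 1, ∃ l, Filter.Tendsto f (nhdsWithin x (Set.Iio x)) (nhds l))

/-- A strictly increasing continuous bijection of `[0,1]` onto itself. -/
def TimeChange (l : ℝ → ℝ) : Prop :=
  StrictMonoOn l (Set.Icc 0 1) ∧ ContinuousOn l (Set.Icc 0 1) ∧
    Set.BijOn l (Set.Icc 0 1) (Set.Icc 0 1)

/-- Uniform (sup) norm on `[0,1]`. -/
def supIcc (f : ℝ → ℝ) : ℝ := ⨆ x : Set.Icc (0:ℝ) 1, |f x.val|

/-- The Skorokhod J1 metric on càdlàg functions on `[0,1]`. -/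
def skorokhodDist (f g : ℝ → ℝ) : ℝ :=
  ⨅ l : { l : ℝ → ℝ // TimeChange l },
    max (supIcc fun x => l.val x - x) (supIcc fun x => f x - g (l.val x))

/-- The LCR functional `φ_LCR(f) = sup_{t∈[0,1]} { f(t) − c t − J_r^t(f) }`. -/
def phiLCR (c : ℝ) (r : ℕ) (f : ℝ → ℝ) : ℝ :=
  ⨆ t : Set.Icc (0:ℝ) 1, (f t.val - c * t.val - J r t.val f)

/-- The ECOMOR functional
`φ_EC(f) = sup_{t∈[0,1]} { f(t) − c t − (r+1)·J_r^t(f) + r·J_{r+1}^t(f) }`. -/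
def phiEC (c : ℝ) (r : ℕ) (f : ℝ → ℝ) : ℝ :=
  ⨆ t : Set.Icc (0:ℝ) 1,
    (f t.val - c * t.val - ((r:ℝ) + 1) * J r t.val f + (r:ℝ) * J (r+1) t.val f)

/-- The step function `x ↦ ∑ i, y i · 1_{[τ i, 1]}(x)`, viewed as a function on `ℝ`. -/
def stepFun {k : ℕ} (y τ : Fin k → ℝ) : ℝ → ℝ :=
  fun x => ∑ i, if τ i ≤ x then y i else 0

/-- Nondecreasing step functions vanishing at the origin with at most `j` steps. -/
def stepSet (j : ℕ) : Set (ℝ → ℝ) :=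
  { f | ∃ k : ℕ, k ≤ j ∧ ∃ y τ : Fin k → ℝ,
      (∀ i, 0 < y i) ∧ (∀ i, τ i ∈ Set.Ioo (0:ℝ) 1) ∧ Function.Injective τ ∧
      f = stepFun y τ }

/-- Skorokhod distance from a function to a set of functions. -/
def distToSet (f : ℝ → ℝ) (A : Set (ℝ → ℝ)) : ℝ := ⨅ g : A, skorokhodDist f g.val

/-- The Gauss hypergeometric function `₂F₁(b,e;d;z)`. -/
def hyp2F1 (b e d z : ℝ) : ℝ :=
  ∑' k : ℕ, ((ascPochhammer ℝ k).eval b * (ascPochhammer ℝ k).eval e /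
    (ascPochhammer ℝ k).eval d) * z ^ k / (k.factorial : ℝ)

end

theorem leftLim_stepFun {k : ℕ} (y τ : Fin k → ℝ) (s : ℝ) :
    Function.leftLim (stepFun y τ) s = ∑ i, if τ i < s then y i else 0 := by
  refine leftLim_eq_of_tendsto (tendsto_finsetSum _ fun i _ => ?_)
  by_cases h : τ i < s
  · refine tendsto_const_nhds.congr' ?_
    filter_upwards [Ioo_mem_nhdsLT h] with x hx
    simp [h, hx.1.le]
  · refine tendsto_const_nhds.congr' ?_
    filter_upwards [self_mem_nhdsWithin] with x hx
    have : ¬ τ i ≤ x := fun h' => h (h'.trans_lt hx)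
    simp [h, this]

theorem jumpAt_stepFun {k : ℕ} (y τ : Fin k → ℝ) (hτ : ∀ i, 0 < τ i) (s : ℝ) :
    jumpAt (stepFun y τ) s = ∑ i, if τ i = s then y i else 0 := by
  unfold jumpAt
  split_ifs with h
  · subst h
    simp [fun i => (hτ i).ne']
  · rw [leftLim_stepFun, stepFun, ← Finset.sum_sub_distrib]
    refine Finset.sum_congr rfl fun i _ => ?_
    rcases lt_trichotomy (τ i) s with h | h | h
    · simp [h, h.le, h.ne]
    · simp [h]
    · simp [h.not_gt, h.not_ge, h.ne']

theorem jumpAt_stepFun_nonneg {k : ℕ} (y τ : Fin k → ℝ) (hy : ∀ i, 0 < y i)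
    (hτ : ∀ i, 0 < τ i) (s : ℝ) : 0 ≤ jumpAt (stepFun y τ) s := by
  rw [jumpAt_stepFun y τ hτ]
  exact Finset.sum_nonneg fun i _ => by split_ifs <;> simp [(hy i).le]

theorem stepFun_nonneg {k : ℕ} (y τ : Fin k → ℝ) (hy : ∀ i, 0 < y i) (t : ℝ) :
    0 ≤ stepFun y τ t :=
  Finset.sum_nonneg fun i _ => by split_ifs <;> simp [(hy i).le]

theorem J_stepFun_nonneg {k : ℕ} (y τ : Fin k → ℝ) (hy : ∀ i, 0 < y i)
    (hτ : ∀ i, 0 < τ i) (m : ℕ) (t : ℝ) : 0 ≤ J m t (stepFun y τ) :=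
  Real.iSup_nonneg fun _ => Finset.sum_nonneg fun _ _ => jumpAt_stepFun_nonneg y τ hy hτ _

theorem sum_jumpAt_stepFun_le {k : ℕ} (y τ : Fin k → ℝ) (hy : ∀ i, 0 < y i)
    (hτ : ∀ i, 0 < τ i) {m : ℕ} {t : ℝ} (s : Fin m → ℝ) (hs : ∀ i, s i ∈ Set.Icc 0 t)
    (hinj : Function.Injective s) :
    ∑ i, jumpAt (stepFun y τ) (s i) ≤ stepFun y τ t := by
  simp_rw [jumpAt_stepFun y τ hτ]
  rw [Finset.sum_comm]
  refine Finset.sum_le_sum fun i _ => ?_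
  by_cases h : ∃ n, τ i = s n
  · obtain ⟨n, hn⟩ := h
    simp [hn, hinj.eq_iff, (hs n).2]
  · push Not at h
    simp only [h, if_false, Finset.sum_const_zero]
    split_ifs <;> simp [(hy i).le]

theorem J_stepFun_le {k : ℕ} (y τ : Fin k → ℝ) (hy : ∀ i, 0 < y i)
    (hτ : ∀ i, 0 < τ i) (m : ℕ) (t : ℝ) : J m t (stepFun y τ) ≤ stepFun y τ t :=
  Real.iSup_le (fun s => sum_jumpAt_stepFun_le y τ hy hτ s.1 s.2.1 s.2.2)
    (stepFun_nonneg y τ hy t)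

/-- With at least as many jump points as steps, `J` recovers the whole step function. -/
theorem J_stepFun_eq {k : ℕ} (y τ : Fin k → ℝ) (hy : ∀ i, 0 < y i)
    (hτ : ∀ i, 0 < τ i) {m : ℕ} (hkm : k ≤ m) {t : ℝ} (ht : 0 ≤ t) :
    J m t (stepFun y τ) = stepFun y τ t := by
  classical
  refine le_antisymm (J_stepFun_le y τ hy hτ m t) ?_
  rcases ht.eq_or_lt with rfl | ht
  · have : stepFun y τ 0 = 0 := by simp [stepFun, fun i => (hτ i).not_ge]
    rw [this]
    exact J_stepFun_nonneg y τ hy hτ m 0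
  · set A : Finset ℝ := (Finset.univ.filter fun i => τ i ≤ t).image τ
    have hA : (A : Set ℝ) ⊆ Set.Icc 0 t := by
      intro x hx
      obtain ⟨i, hi, rfl⟩ := Finset.mem_image.1 (Finset.mem_coe.1 hx)
      exact ⟨(hτ i).le, (Finset.mem_filter.1 hi).2⟩
    have hAc : A.card ≤ m := by
      refine Finset.card_image_le.trans ((Finset.card_filter_le _ _).trans ?_)
      simpa using hkm
    obtain ⟨T, hAT, hT, hTc⟩ :=
      Set.exists_superset_subset_encard_eq (k := m) hA (by simpa using hAc)
        (by simp [(Set.Icc_infinite ht).encard_eq])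
    have hTf : T.Finite := Set.finite_of_encard_eq_coe hTc
    have : Fintype T := hTf.fintype
    have hcard : Fintype.card T = m := by
      rw [Set.encard_eq_coe_toFinset_card, Set.toFinset_card] at hTc
      exact_mod_cast hTc
    let e := (Fintype.equivFinOfCardEq hcard).symm
    let s : { s : Fin m → ℝ // (∀ i, s i ∈ Set.Icc 0 t) ∧ Function.Injective s } :=
      ⟨fun i => (e i : ℝ), fun i => hT (e i).2, Subtype.val_injective.comp e.injective⟩
    refine le_ciSup_of_le ⟨stepFun y τ t, ?_⟩ s ?_
    · rintro _ ⟨s, rfl⟩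
      exact sum_jumpAt_stepFun_le y τ hy hτ s.1 s.2.1 s.2.2
    · simp_rw [jumpAt_stepFun y τ hτ]
      rw [Finset.sum_comm]
      refine Finset.sum_le_sum fun i _ => ?_
      have hterm : ∀ n ∈ Finset.univ, 0 ≤ if τ i = s.1 n then y i else 0 :=
        fun n _ => by split_ifs <;> simp [(hy i).le]
      by_cases h : τ i ≤ t
      · have hi : τ i ∈ T :=
          hAT (Finset.mem_coe.2 (Finset.mem_image_of_mem τ (by simp [h])))
        have hn : τ i = s.1 (e.symm ⟨τ i, hi⟩) := by simp [s]
        have := Finset.single_le_sum hterm (Finset.mem_univ (e.symm ⟨τ i, hi⟩))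
        rw [if_pos h]
        rwa [if_pos hn] at this
      · rw [if_neg h]
        exact Finset.sum_nonneg hterm

theorem bddAbove_phiEC_stepFun (c : ℝ) (r : ℕ) {k : ℕ} (y τ : Fin k → ℝ)
    (hy : ∀ i, 0 < y i) (hτ : ∀ i, 0 < τ i) :
    BddAbove (Set.range fun t : Set.Icc (0:ℝ) 1 =>
      stepFun y τ t.val - c * t.val - ((r:ℝ) + 1) * J r t.val (stepFun y τ) +
        (r:ℝ) * J (r+1) t.val (stepFun y τ)) := by
  refine ⟨(∑ i, y i) + |c| + r * ∑ i, y i, ?_⟩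
  rintro _ ⟨⟨t, ht0, ht1⟩, rfl⟩
  have hf : stepFun y τ t ≤ ∑ i, y i :=
    Finset.sum_le_sum fun i _ => by split_ifs <;> simp [(hy i).le]
  have hc : -(c * t) ≤ |c| := by
    refine (neg_le_abs _).trans ?_
    rw [abs_mul, abs_of_nonneg ht0]
    exact mul_le_of_le_one_right (abs_nonneg c) ht1
  have h1 : 0 ≤ ((r:ℝ) + 1) * J r t (stepFun y τ) :=
    mul_nonneg (by positivity) (J_stepFun_nonneg y τ hy hτ r t)
  have h2 : (r:ℝ) * J (r+1) t (stepFun y τ) ≤ r * ∑ i, y i :=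
    mul_le_mul_of_nonneg_left ((J_stepFun_le y τ hy hτ _ t).trans hf) (Nat.cast_nonneg r)
  simp only
  linarith

/-- A step function with at most `r` steps does not reach level `a`. -/
theorem phiEC_stepFun_lt {c a : ℝ} (ha : 0 < a) (hac : 0 < a + c) {r k : ℕ} (hkr : k ≤ r)
    (y τ : Fin k → ℝ) (hy : ∀ i, 0 < y i) (hτ : ∀ i, 0 < τ i) :
    phiEC c r (stepFun y τ) < a := by
  refine lt_of_le_of_lt (b := max 0 (-c)) ?_ (max_lt ha (by linarith))
  refine ciSup_le fun ⟨t, ht0, ht1⟩ => ?_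
  simp only
  rw [J_stepFun_eq y τ hy hτ hkr ht0, J_stepFun_eq y τ hy hτ (hkr.trans r.le_succ) ht0]
  have : -c * t ≤ max 0 (-c) := by
    nlinarith [le_max_left 0 (-c), le_max_right 0 (-c)]
  linarith

theorem J_stepFun_const_le {Y : ℝ} (hY : 0 < Y) {k : ℕ} (τ : Fin k → ℝ) (hτ : ∀ i, 0 < τ i)
    (hinj : Function.Injective τ) (m : ℕ) (t : ℝ) :
    J m t (stepFun (fun _ => Y) τ) ≤ m * Y := by
  refine Real.iSup_le (fun s => ?_) (by positivity)
  have : ∀ i ∈ Finset.univ, jumpAt (stepFun (fun _ => Y) τ) (s.1 i) ≤ Y := by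
    intro i _
    rw [jumpAt_stepFun _ τ hτ]
    by_cases h : ∃ n, τ n = s.1 i
    · obtain ⟨n, hn⟩ := h
      simp [← hn, hinj.eq_iff]
    · push Not at h
      simp [h, hY.le]
  simpa using Finset.sum_le_sum this

theorem le_phiEC_stepFun_const {c a : ℝ} (hac : 0 < a + c) {r : ℕ}
    (τ : Fin (r + 1) → ℝ) (hτ : ∀ i, τ i ∈ Set.Ioo (0:ℝ) 1) (hinj : Function.Injective τ) :
    a ≤ phiEC c r (stepFun (fun _ => a + c) τ) := by
  have hpos := fun i => (hτ i).1
  refine le_trans ?_ (le_ciSup (bddAbove_phiEC_stepFun c r _ τ (fun _ => hac) hpos)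
    ⟨1, zero_le_one, le_rfl⟩)
  have hf : stepFun (fun _ => a + c) τ 1 = ((r:ℝ) + 1) * (a + c) := by
    simp [stepFun, fun i => (hτ i).2.le]
    ring
  have hJ := mul_le_mul_of_nonneg_left (J_stepFun_const_le hac τ hpos hinj r 1)
    (by positivity : (0:ℝ) ≤ r + 1)
  have hr : 0 ≤ (r:ℝ) * (a + c) := by positivity
  simp only
  rw [J_stepFun_eq _ τ (fun _ => hac) hpos le_rfl zero_le_one, hf]
  nlinarith

/-- the minimal number of steps of a nondecreasing step function vanishing
at the origin that belongs to `A_EC = {φ_EC ≥ a}` is `r+1`. -/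
theorem rate_function_EC (c a : ℝ) (ha : 0 < a) (hac : 0 < a + c)
    (r : ℕ) (hr : 1 ≤ r) :
    sInf { j : ℕ | ∃ y τ : Fin j → ℝ,
        (∀ i, 0 < y i) ∧ (∀ i, τ i ∈ Set.Ioo (0:ℝ) 1) ∧ Function.Injective τ ∧
        a ≤ phiEC c r (stepFun y τ) } = r + 1 := by
  refine IsLeast.csInf_eq ⟨?_, ?_⟩
  · have hd : (0:ℝ) < r + 2 := by positivity
    have hτ : ∀ i : Fin (r + 1), ((i:ℝ) + 1) / (r + 2) ∈ Set.Ioo (0:ℝ) 1 := by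
      intro i
      have hi : (i:ℝ) + 1 ≤ r + 1 := by exact_mod_cast i.2
      exact ⟨by positivity, by rw [div_lt_one hd]; linarith⟩
    have hinj : Function.Injective fun i : Fin (r + 1) => ((i:ℝ) + 1) / (r + 2) := by
      intro i j hij
      simpa [div_left_inj' hd.ne', Fin.val_inj] using hij
    exact ⟨fun _ => a + c, _, fun _ => hac, hτ, hinj, le_phiEC_stepFun_const hac _ hτ hinj⟩
  · rintro j ⟨y, τ, hy, hτ, -, hphi⟩
    by_contra! hj
    exact hphi.not_gt (phiEC_stepFun_lt ha hac (by omega) y τ hy fun i => (hτ i).1)
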